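/- arXiv:1310.4606 — 2 statements merged into one kernel-verified Lean document; each statement's English description precedes it below -/
import Mathlib

section
/- Suppose np = Ω(log n) and m/n → α < ∞ as n → ∞, with mp and np integers. Then the Erdős–Rényi random bipartite graph G(m,n,p) is (mp,np)-regular (every vertex on the side of size m has degree np and every vertex on the side of size n has degree mp) with probability at least exp(−O(n·(np)^{1/2})). -/
open MeasureTheory ProbabilityTheory Filter Matrix
open scoped ENNReal Topology

/-- Bernoulli(p) measure on `ℝ`: mass `p` at `1` and `1-p` at `0`. -/
noncomputable def bern (p : ℝ) : Measure ℝ :=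
  ENNReal.ofReal p • Measure.dirac 1 + ENNReal.ofReal (1 - p) • Measure.dirac 0

/-- The law of the Erdős–Rényi bipartite random graph `G(m,n,p)`, encoded by the
`m × n` 0-1 matrix of edge indicators, whose entries are i.i.d. Bernoulli(p). -/
noncomputable def erMeas (m n : ℕ) (p : ℝ) : Measure (Fin m → Fin n → ℝ) :=
  Measure.pi fun _ => Measure.pi fun _ => bern p

section Counting

variable {ι κ : Type*}

open Classical in
/-- The `0`-`1` matrices with row sums `r` and column sums `s`. -/
noncomputable def binaryMatrices [Fintype ι] [Fintype κ] (r : ι → ℕ) (s : κ → ℕ) :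
    Finset (ι → κ → Bool) :=
  {A | (∀ i, ∑ j, (A i j).toNat = r i) ∧ ∀ j, ∑ i, (A i j).toNat = s j}

lemma mem_binaryMatrices [Fintype ι] [Fintype κ] {r : ι → ℕ} {s : κ → ℕ} {A : ι → κ → Bool} :
    A ∈ binaryMatrices r s ↔
      (∀ i, ∑ j, (A i j).toNat = r i) ∧ ∀ j, ∑ i, (A i j).toNat = s j := by
  simp [binaryMatrices]

lemma card_binaryMatrices_transpose [Fintype ι] [Fintype κ] (r : ι → ℕ) (s : κ → ℕ) :
    (binaryMatrices r s).card = (binaryMatrices s r).card := by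
  refine Finset.card_nbij' (fun A j i => A i j) (fun A i j => A j i) ?_ ?_ ?_ ?_ <;>
    simp +contextual [Set.MapsTo, Set.LeftInvOn, mem_binaryMatrices]

/-- Exchange the entries in columns `a` and `b` of row `i`. -/
def swapInRow [DecidableEq ι] [DecidableEq κ] (a b : κ) (i : ι) (A : ι → κ → Bool) :
    ι → κ → Bool :=
  Function.update A i fun j => A i (Equiv.swap a b j)

lemma swapInRow_comm [DecidableEq ι] [DecidableEq κ] (a b : κ) (i : ι) (A : ι → κ → Bool) :
    swapInRow a b i A = swapInRow b a i A := by
  rw [swapInRow, swapInRow, Equiv.swap_comm]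

lemma swapInRow_swapInRow [DecidableEq ι] [DecidableEq κ] (a b : κ) (i : ι) (A : ι → κ → Bool) :
    swapInRow a b i (swapInRow a b i A) = A := by
  funext k j
  rcases eq_or_ne k i with rfl | hk <;> simp [swapInRow, *]

lemma sum_row_swapInRow [Fintype κ] [DecidableEq ι] [DecidableEq κ] (a b : κ) (i : ι)
    (A : ι → κ → Bool) (k : ι) :
    ∑ j, (swapInRow a b i A k j).toNat = ∑ j, (A k j).toNat := by
  rcases eq_or_ne k i with rfl | hk
  · simpa [swapInRow] using Equiv.sum_comp (Equiv.swap a b) fun j => (A k j).toNat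
  · simp [swapInRow, hk]

lemma sum_col_swapInRow [Fintype ι] [DecidableEq ι] [DecidableEq κ] (a b : κ) (i : ι)
    (A : ι → κ → Bool) (j : κ) :
    ∑ k, (swapInRow a b i A k j).toNat + (A i j).toNat =
      ∑ k, (A k j).toNat + (A i (Equiv.swap a b j)).toNat := by
  rw [← Finset.add_sum_erase _ _ (Finset.mem_univ i),
    ← Finset.add_sum_erase _ (fun k => (A k j).toNat) (Finset.mem_univ i)]
  have : ∑ k ∈ Finset.univ.erase i, (swapInRow a b i A k j).toNat =
      ∑ k ∈ Finset.univ.erase i, (A k j).toNat :=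
    Finset.sum_congr rfl fun k hk => by simp [swapInRow, Finset.ne_of_mem_erase hk]
  rw [this]
  simp [swapInRow]
  ring

/-- The rows that have a one in column `a` and a zero in column `b`. -/
def exchangeRows [Fintype ι] (a b : κ) (A : ι → κ → Bool) : Finset ι :=
  {i | A i a = true ∧ A i b = false}

lemma mem_exchangeRows [Fintype ι] {a b : κ} {A : ι → κ → Bool} {i : ι} :
    i ∈ exchangeRows a b A ↔ A i a = true ∧ A i b = false := by
  simp [exchangeRows]

lemma card_exchangeRows_add [Fintype ι] (a b : κ) (A : ι → κ → Bool) :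
    (exchangeRows a b A).card + ∑ i, (A i b).toNat =
      (exchangeRows b a A).card + ∑ i, (A i a).toNat := by
  simp only [exchangeRows, Finset.card_filter, ← Finset.sum_add_distrib]
  refine Finset.sum_congr rfl fun i _ => ?_
  cases A i a <;> cases A i b <;> simp

lemma swapInRow_mem_exchangeRows [Fintype ι] [DecidableEq ι] [DecidableEq κ] {a b : κ}
    {A : ι → κ → Bool} {i : ι} :
    i ∈ exchangeRows b a (swapInRow a b i A) ↔ i ∈ exchangeRows a b A := by
  simp [mem_exchangeRows, swapInRow]

lemma card_exchangeRows_swapInRow [Fintype ι] [DecidableEq ι] [DecidableEq κ] {a b : κ}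
    {A : ι → κ → Bool} {i : ι} (hi : i ∈ exchangeRows a b A) :
    (exchangeRows b a (swapInRow a b i A)).card = (exchangeRows b a A).card + 1 := by
  have hn : i ∉ exchangeRows b a A := by
    rw [mem_exchangeRows] at hi ⊢
    simp [hi]
  rw [← Finset.card_insert_of_notMem hn]
  congr 1
  ext k
  rcases eq_or_ne k i with rfl | hk
  · simp [swapInRow_mem_exchangeRows, hi]
  · simp [mem_exchangeRows, swapInRow, hk]

lemma swapInRow_mem_binaryMatrices [Fintype ι] [Fintype κ] [DecidableEq ι] [DecidableEq κ]
    {r : ι → ℕ} {s t : κ → ℕ} {a b : κ} (hta : t a + 1 = s a) (htb : t b = s b + 1)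
    (ht : ∀ j, j ≠ a → j ≠ b → t j = s j) {A : ι → κ → Bool} (hA : A ∈ binaryMatrices r s)
    {i : ι} (hi : i ∈ exchangeRows a b A) :
    swapInRow a b i A ∈ binaryMatrices r t := by
  rw [mem_binaryMatrices] at hA ⊢
  rw [mem_exchangeRows] at hi
  refine ⟨fun k => (sum_row_swapInRow ..).trans (hA.1 k), fun j => ?_⟩
  have h := sum_col_swapInRow a b i A j
  rw [hA.2 j] at h
  by_cases ha : j = a
  · subst ha
    rw [Equiv.swap_apply_left, hi.1, hi.2, Bool.toNat_true, Bool.toNat_false] at h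
    omega
  by_cases hb : j = b
  · subst hb
    rw [Equiv.swap_apply_right, hi.1, hi.2, Bool.toNat_true, Bool.toNat_false] at h
    omega
  rw [Equiv.swap_apply_of_ne_of_ne ha hb] at h
  rw [ht j ha hb]
  omega

/-- Moving a unit from a larger column sum to a smaller one does not decrease the number of
`0`-`1` matrices. -/
lemma card_binaryMatrices_le_of_transfer [Fintype ι] [Fintype κ] {r : ι → ℕ} {s t : κ → ℕ}
    {a b : κ} (hlt : s b < s a) (hta : t a + 1 = s a) (htb : t b = s b + 1)
    (ht : ∀ j, j ≠ a → j ≠ b → t j = s j) :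
    (binaryMatrices r s).card ≤ (binaryMatrices r t).card := by
  classical
  have hbij : ∑ x ∈ (binaryMatrices r s).sigma (exchangeRows a b),
      ((exchangeRows b a (swapInRow a b x.2 x.1)).card : ℚ)⁻¹ =
      ∑ x ∈ (binaryMatrices r t).sigma (exchangeRows b a),
        ((exchangeRows b a x.1).card : ℚ)⁻¹ := by
    refine Finset.sum_nbij' (fun x => ⟨swapInRow a b x.2 x.1, x.2⟩)
      (fun x => ⟨swapInRow b a x.2 x.1, x.2⟩) ?_ ?_ ?_ ?_ fun _ _ => rfl
    · rintro ⟨A, i⟩ h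
      rw [Finset.mem_sigma] at h ⊢
      exact ⟨swapInRow_mem_binaryMatrices hta htb ht h.1 h.2, swapInRow_mem_exchangeRows.2 h.2⟩
    · rintro ⟨A, i⟩ h
      rw [Finset.mem_sigma] at h ⊢
      exact ⟨swapInRow_mem_binaryMatrices htb.symm hta.symm (fun j hb ha => (ht j ha hb).symm)
        h.1 h.2, swapInRow_mem_exchangeRows.2 h.2⟩
    all_goals
      rintro ⟨A, i⟩ _
      simp [swapInRow_comm b a, swapInRow_swapInRow]
  have hle : ∑ x ∈ (binaryMatrices r s).sigma (exchangeRows a b),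
      ((exchangeRows a b x.1).card : ℚ)⁻¹ ≤
      ∑ x ∈ (binaryMatrices r s).sigma (exchangeRows a b),
        ((exchangeRows b a (swapInRow a b x.2 x.1)).card : ℚ)⁻¹ := by
    refine Finset.sum_le_sum ?_
    rintro ⟨A, i⟩ h
    rw [Finset.mem_sigma] at h
    have h1 := card_exchangeRows_add a b A
    rw [(mem_binaryMatrices.1 h.1).2, (mem_binaryMatrices.1 h.1).2] at h1
    rw [card_exchangeRows_swapInRow h.2]
    gcongr
    dsimp only
    omega
  have hleft : ∑ x ∈ (binaryMatrices r s).sigma (exchangeRows a b),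
      ((exchangeRows a b x.1).card : ℚ)⁻¹ = (binaryMatrices r s).card := by
    rw [Finset.sum_sigma, Finset.card_eq_sum_ones, Nat.cast_sum]
    refine Finset.sum_congr rfl fun A hA => ?_
    have h1 := card_exchangeRows_add a b A
    rw [(mem_binaryMatrices.1 hA).2, (mem_binaryMatrices.1 hA).2] at h1
    have : ((exchangeRows a b A).card : ℚ) ≠ 0 := by
      rw [Nat.cast_ne_zero]
      omega
    simp [this]
  have hright : ∑ x ∈ (binaryMatrices r t).sigma (exchangeRows b a),
      ((exchangeRows b a x.1).card : ℚ)⁻¹ ≤ (binaryMatrices r t).card := by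
    rw [Finset.sum_sigma, Finset.card_eq_sum_ones, Nat.cast_sum]
    refine Finset.sum_le_sum fun A _ => ?_
    simpa using mul_inv_le_one
  exact_mod_cast hleft ▸ (hle.trans hbij.le).trans hright

/-- For given row sums, equal column sums maximize the number of `0`-`1` matrices. -/
lemma card_binaryMatrices_le_const [Fintype ι] [Fintype κ] (r : ι → ℕ) (s : κ → ℕ) (e : ℕ)
    (hs : ∑ j, s j = Fintype.card κ * e) :
    (binaryMatrices r s).card ≤ (binaryMatrices r fun _ : κ => e).card := by
  classical
  induction hq : ∑ j, s j ^ 2 using Nat.strong_induction_on generalizing s with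
  | _ q ih =>
  by_cases hconst : s = fun _ => e
  · rw [hconst]
  have hsum : ∑ j, s j = ∑ _j : κ, e := by simp [hs]
  obtain ⟨a, ha⟩ : ∃ a, e < s a := by
    by_contra! h
    exact hconst (funext fun j =>
      (Finset.sum_eq_sum_iff_of_le fun j _ => h j).1 hsum j (Finset.mem_univ j))
  obtain ⟨b, hb⟩ : ∃ b, s b < e := by
    by_contra! h
    exact hconst (funext fun j =>
      ((Finset.sum_eq_sum_iff_of_le fun j _ => h j).1 hsum.symm j (Finset.mem_univ j)).symm)
  have hab : a ≠ b := by rintro rfl; omega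
  set t := Function.update (Function.update s a (s a - 1)) b (s b + 1) with htdef
  have hta : t a = s a - 1 := by simp [htdef, hab]
  have htb : t b = s b + 1 := by simp [htdef]
  have ht : ∀ j, j ≠ a → j ≠ b → t j = s j := fun j h1 h2 => by simp [htdef, h1, h2]
  have split (f : κ → ℕ) : ∑ j, f j = f a + (f b + ∑ j ∈ (Finset.univ.erase a).erase b, f j) := by
    rw [Finset.add_sum_erase _ _ (by simp [hab.symm]), Finset.add_sum_erase _ _ (by simp)]
  have rest (f : ℕ → ℕ) : ∑ j ∈ (Finset.univ.erase a).erase b, f (t j) =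
      ∑ j ∈ (Finset.univ.erase a).erase b, f (s j) :=
    Finset.sum_congr rfl fun j hj => by
      simp only [Finset.mem_erase] at hj
      rw [ht j hj.2.1 hj.1]
  refine (card_binaryMatrices_le_of_transfer (by omega) (by omega) htb ht).trans
    (ih _ ?_ t ?_ rfl)
  · rw [← hq, split fun j => t j ^ 2, split fun j => s j ^ 2, rest fun x => x ^ 2, hta, htb]
    obtain ⟨u, hu⟩ : ∃ u, s a = u + 1 := ⟨s a - 1, by omega⟩
    rw [hu, Nat.add_sub_cancel]
    nlinarith
  · have := rest id
    simp only [id] at this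
    rw [← hs, split t, split s, this, hta, htb]
    omega


lemma card_piAntidiag_le [Fintype κ] [DecidableEq κ] (e : ℕ) :
    ((Finset.piAntidiag (Finset.univ : Finset κ) (Fintype.card κ * e)).card : ℝ) ≤
      Real.exp (Fintype.card κ) * (e + 1) ^ Fintype.card κ := by
  set a := Fintype.card κ with ha
  have hcard : (Finset.piAntidiag (Finset.univ : Finset κ) (a * e)).card ≤
      (a * e + a).choose a := by
    have h1 : (Finset.piAntidiag (Finset.univ : Finset κ) (a * e)).card =
        ((Finset.univ : Finset κ).finsuppAntidiag (a * e)).card := by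
      simp [Finset.finsuppAntidiag]
    rw [h1, Finset.card_finsuppAntidiag_nat_eq_choose, Finset.card_univ, ← ha,
      Nat.choose_symm_add.symm, Nat.add_comm (a * e) a]
    exact Nat.choose_le_choose _ (Nat.sub_le _ _)
  have hx : (0 : ℝ) < (e : ℝ) + 1 := by positivity
  have hsum : (((a * e + a).choose a : ℕ) : ℝ) * (1 / ((e : ℝ) + 1)) ^ a ≤
      (1 / ((e : ℝ) + 1) + 1) ^ (a * e + a) := by
    rw [add_pow]
    refine le_trans (le_of_eq ?_) (Finset.single_le_sum (f := fun k =>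
      (1 / ((e : ℝ) + 1)) ^ k * 1 ^ (a * e + a - k) * ((a * e + a).choose k : ℝ))
      (fun k _ => by positivity) (Finset.mem_range.2 (by omega : a < a * e + a + 1)))
    simp [mul_comm]
  have hexp : (1 / ((e : ℝ) + 1) + 1) ^ (a * e + a) ≤ Real.exp a := by
    calc (1 / ((e : ℝ) + 1) + 1) ^ (a * e + a)
        ≤ Real.exp (1 / ((e : ℝ) + 1)) ^ (a * e + a) := by
          gcongr
          exact Real.add_one_le_exp _
      _ = Real.exp a := by
          rw [← Real.exp_nat_mul]
          congr 1
          push_cast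
          field_simp
  rw [one_div, inv_pow, ← div_eq_mul_inv, div_le_iff₀ (by positivity), ← one_div] at hsum
  calc ((Finset.piAntidiag (Finset.univ : Finset κ) (a * e)).card : ℝ)
      ≤ ((a * e + a).choose a : ℕ) := by exact_mod_cast hcard
    _ ≤ _ := hsum
    _ ≤ _ := by gcongr

/-- The `d`-`e`-biregular matrices make up a large part of all matrices with the same total. -/
lemma choose_le_mul_card_binaryMatrices [Fintype ι] [Fintype κ] {d e : ℕ}
    (hde : Fintype.card ι * d = Fintype.card κ * e) :
    (((Fintype.card ι * Fintype.card κ).choose (Fintype.card ι * d) : ℕ) : ℝ) ≤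
      (Real.exp (Fintype.card ι) * (d + 1) ^ Fintype.card ι) *
      (Real.exp (Fintype.card κ) * (e + 1) ^ Fintype.card κ) *
      (binaryMatrices (fun _ : ι => d) fun _ : κ => e).card := by
  classical
  set R := Finset.piAntidiag (Finset.univ : Finset ι) (Fintype.card ι * d)
  set S := Finset.piAntidiag (Finset.univ : Finset κ) (Fintype.card κ * e)
  have hmax : ∀ r ∈ R, ∀ s ∈ S, (binaryMatrices r s).card ≤
      (binaryMatrices (fun _ : ι => d) fun _ : κ => e).card := by
    intro r hr s hs
    rw [Finset.mem_piAntidiag] at hr hs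
    refine (card_binaryMatrices_le_const r s e hs.1).trans ?_
    rw [card_binaryMatrices_transpose, card_binaryMatrices_transpose (fun _ => d)]
    exact card_binaryMatrices_le_const _ r d hr.1
  have hcover : (Finset.powersetCard (Fintype.card ι * d)
      (Finset.univ : Finset (ι × κ))).card ≤
      ((R ×ˢ S).biUnion fun x => binaryMatrices x.1 x.2).card := by
    refine Finset.card_le_card_of_injOn (fun E i j => decide ((i, j) ∈ E)) ?_ ?_
    · intro E hE
      have hcard : ∑ i, ∑ j, (decide ((i, j) ∈ E)).toNat = Fintype.card ι * d := by
        rw [← Fintype.sum_prod_type' (f := fun i j => (decide ((i, j) ∈ E)).toNat),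
          ← (Finset.mem_powersetCard.1 hE).2]
        simp [Bool.toNat, Bool.cond_decide]
      have hcard' := hcard
      rw [Finset.sum_comm, hde] at hcard'
      simp only [Finset.coe_biUnion, Set.mem_iUnion, Finset.mem_coe]
      exact ⟨(fun i => ∑ j, (decide ((i, j) ∈ E)).toNat,
        fun j => ∑ i, (decide ((i, j) ∈ E)).toNat),
        by simpa [R, S, Finset.mem_piAntidiag] using ⟨hcard, hcard'⟩,
        mem_binaryMatrices.2 ⟨fun _ => rfl, fun _ => rfl⟩⟩
    · intro E _ F _ h
      ext ⟨i, j⟩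
      simpa using congrFun (congrFun h i) j
  rw [Finset.card_powersetCard, Finset.card_univ, Fintype.card_prod] at hcover
  have hbound : ((R ×ˢ S).biUnion fun x => binaryMatrices x.1 x.2).card ≤
      R.card * S.card * (binaryMatrices (fun _ : ι => d) fun _ : κ => e).card := by
    rw [← Finset.card_product]
    refine Finset.card_biUnion_le_card_mul _ _ _ fun x hx => ?_
    rw [Finset.mem_product] at hx
    exact hmax _ hx.1 _ hx.2
  calc _ ≤ ((R.card * S.card *
        (binaryMatrices (fun _ : ι => d) fun _ : κ => e).card : ℕ) : ℝ) := by
        exact_mod_cast hcover.trans hbound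
    _ ≤ _ := by
        push_cast
        gcongr
        · exact card_piAntidiag_le d
        · exact card_piAntidiag_le e

end Counting

/-- The binomial distribution with integer mean `k` has its mode at `k`. -/
lemma binomial_le_binomial_mean {N k : ℕ} {p : ℝ} (hp0 : 0 < p) (hp1 : p < 1)
    (hk : (N : ℝ) * p = k) (j : ℕ) :
    p ^ j * (1 - p) ^ (N - j) * N.choose j ≤ p ^ k * (1 - p) ^ (N - k) * N.choose k := by
  set f : ℕ → ℝ := fun j => p ^ j * (1 - p) ^ (N - j) * N.choose j with hf
  have hq : 0 < 1 - p := by linarith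
  have hf0 : ∀ j, 0 ≤ f j := fun j => by positivity
  have hstep : ∀ j < N, ((j : ℝ) + 1) * (1 - p) * f (j + 1) = (N - j) * p * f j := by
    intro j hj
    have h1 := Nat.choose_succ_right_eq N j
    have h2 : (N.choose (j + 1) : ℝ) * (j + 1) = N.choose j * (N - j) := by
      rw [← Nat.cast_sub hj.le]
      exact_mod_cast h1
    have h3 : N - j = N - (j + 1) + 1 := by omega
    simp only [hf]
    rw [h3, pow_succ, pow_succ]
    linear_combination p ^ j * p * (1 - p) ^ (N - (j + 1)) * (1 - p) * h2
  have hup : ∀ j < k, f j ≤ f (j + 1) := by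
    intro j hj
    have hj' : (j : ℝ) + 1 ≤ k := by exact_mod_cast hj
    have hjN : j < N := by
      have : (k : ℝ) ≤ N := by rw [← hk]; nlinarith [(Nat.cast_nonneg N : (0 : ℝ) ≤ N)]
      exact hj.trans_le (by exact_mod_cast this)
    have hpos : 0 < ((j : ℝ) + 1) * (1 - p) := by positivity
    refine le_of_mul_le_mul_left ?_ hpos
    rw [hstep j hjN]
    refine mul_le_mul_of_nonneg_right ?_ (hf0 j)
    nlinarith
  have hdown : ∀ j, k ≤ j → f (j + 1) ≤ f j := by
    intro j hj
    rcases lt_or_ge j N with hjN | hjN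
    · have hj' : (k : ℝ) ≤ j := by exact_mod_cast hj
      have hpos : 0 < ((j : ℝ) + 1) * (1 - p) := by positivity
      refine le_of_mul_le_mul_left ?_ hpos
      rw [hstep j hjN]
      refine mul_le_mul_of_nonneg_right ?_ (hf0 j)
      nlinarith
    · have : f (j + 1) = 0 := by simp [hf, Nat.choose_eq_zero_of_lt (Nat.lt_succ_of_le hjN)]
      rw [this]
      exact hf0 j
  rcases le_total j k with h | h
  · exact Nat.decreasingInduction' (P := fun i => f i ≤ f k)
      (fun i hi _ ih => (hup i hi).trans ih) h le_rfl
  · exact Nat.le_induction (P := fun i _ => f i ≤ f k) le_rfl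
      (fun i hi ih => (hdown i hi).trans ih) j h

lemma one_le_mul_binomial_mean {N k : ℕ} {p : ℝ} (hp0 : 0 ≤ p) (hp1 : p ≤ 1)
    (hk : (N : ℝ) * p = k) :
    1 ≤ ((N : ℝ) + 1) * (p ^ k * (1 - p) ^ (N - k) * N.choose k) := by
  rcases hp0.eq_or_lt with rfl | hp0
  · obtain rfl : k = 0 := by simpa using hk.symm
    simp
  rcases hp1.eq_or_lt with rfl | hp1
  · obtain rfl : N = k := by simpa using hk
    simp
  calc (1 : ℝ) = ∑ j ∈ Finset.range (N + 1), p ^ j * (1 - p) ^ (N - j) * N.choose j := by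
        rw [← add_pow]
        simp
    _ ≤ ∑ _j ∈ Finset.range (N + 1), p ^ k * (1 - p) ^ (N - k) * N.choose k :=
        Finset.sum_le_sum fun j _ => binomial_le_binomial_mean hp0 hp1 hk j
    _ = _ := by simp

lemma isProbabilityMeasure_bern {p : ℝ} (hp0 : 0 ≤ p) (hp1 : p ≤ 1) :
    IsProbabilityMeasure (bern p) := by
  constructor
  simp [bern, ← ENNReal.ofReal_add hp0 (sub_nonneg.2 hp1)]

lemma bern_singleton_toNat (p : ℝ) (b : Bool) :
    bern p {((b.toNat : ℕ) : ℝ)} = ENNReal.ofReal (p ^ b.toNat * (1 - p) ^ (!b).toNat) := by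
  cases b <;> simp [bern]

lemma erMeas_singleton {m n : ℕ} {p : ℝ} (hp0 : 0 ≤ p) (hp1 : p ≤ 1)
    (A : Fin m → Fin n → Bool) {k : ℕ} (hA : ∑ i, ∑ j, (A i j).toNat = k) :
    erMeas m n p {fun i j => ((A i j).toNat : ℝ)} =
      ENNReal.ofReal (p ^ k * (1 - p) ^ (m * n - k)) := by
  have := isProbabilityMeasure_bern hp0 hp1
  have hq : 0 ≤ 1 - p := sub_nonneg.2 hp1
  have hnot : ∑ i, ∑ j, (!A i j).toNat = m * n - k := by
    have h : ∑ i, ∑ j, (A i j).toNat + ∑ i, ∑ j, (!A i j).toNat = m * n := by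
      simp only [← Finset.sum_add_distrib]
      rw [Finset.sum_congr rfl fun i _ => Finset.sum_congr rfl fun j _ =>
        (by cases A i j <;> rfl : (A i j).toNat + (!A i j).toNat = 1)]
      simp
    omega
  rw [erMeas, Measure.pi_singleton]
  simp_rw [Measure.pi_singleton, bern_singleton_toNat]
  rw [Finset.prod_congr rfl fun i _ =>
    (ENNReal.ofReal_prod_of_nonneg fun j _ => by positivity).symm,
    ← ENNReal.ofReal_prod_of_nonneg fun i _ => Finset.prod_nonneg fun j _ => by positivity]
  simp_rw [Finset.prod_mul_distrib, Finset.prod_pow_eq_pow_sum, hA, hnot]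

/-- A non-asymptotic lower bound for the probability of being biregular. -/
lemma inv_le_erMeas_biregular {m n d e : ℕ} {p : ℝ} (hp0 : 0 ≤ p) (hp1 : p ≤ 1)
    (hd : (n : ℝ) * p = d) (he : (m : ℝ) * p = e) :
    ENNReal.ofReal ((((m * n : ℕ) : ℝ) + 1) * ((Real.exp m * (d + 1) ^ m) *
      (Real.exp n * (e + 1) ^ n)))⁻¹ ≤ erMeas m n p
        {Y | (∀ i, ∑ j, Y i j = (n : ℝ) * p) ∧ (∀ j, ∑ i, Y i j = (m : ℝ) * p)} := by
  have hde : m * d = n * e := by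
    have : (m : ℝ) * d = n * e := by rw [← hd, ← he]; ring
    exact_mod_cast this
  have hk : ((m * n : ℕ) : ℝ) * p = (m * d : ℕ) := by
    push_cast
    rw [← hd]
    ring
  set B := binaryMatrices (fun _ : Fin m => d) fun _ : Fin n => e
  set w := p ^ (m * d) * (1 - p) ^ (m * n - m * d)
  have hw : 0 ≤ w := by have := sub_nonneg.2 hp1; positivity
  set F : (Fin m → Fin n → Bool) → Fin m → Fin n → ℝ := fun A i j => ((A i j).toNat : ℝ) with hF
  have hFinj : Function.Injective F := by
    intro A A' h
    funext i j
    have := congrFun (congrFun h i) j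
    simp only [hF, Nat.cast_inj] at this
    revert this; cases A i j <;> cases A' i j <;> simp
  have hmeas : erMeas m n p ↑(B.map ⟨F, hFinj⟩) = ENNReal.ofReal (B.card * w) := by
    rw [← sum_measure_singleton, Finset.sum_map, ENNReal.ofReal_mul (by positivity),
      ENNReal.ofReal_natCast, ← nsmul_eq_mul]
    refine Finset.sum_eq_card_nsmul fun A hA => ?_
    refine erMeas_singleton hp0 hp1 A ?_
    simp [(mem_binaryMatrices.1 hA).1]
  have hsub : (↑(B.map ⟨F, hFinj⟩) : Set (Fin m → Fin n → ℝ)) ⊆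
      {Y | (∀ i, ∑ j, Y i j = (n : ℝ) * p) ∧ (∀ j, ∑ i, Y i j = (m : ℝ) * p)} := by
    intro Y hY
    simp only [Finset.coe_map, Set.mem_image, Finset.mem_coe] at hY
    obtain ⟨A, hA, rfl⟩ := hY
    rw [mem_binaryMatrices] at hA
    simp only [Function.Embedding.coeFn_mk, hF, Set.mem_ofPred_eq, hd, he]
    exact ⟨fun i => by exact_mod_cast hA.1 i, fun j => by exact_mod_cast hA.2 j⟩
  refine le_trans ?_ (measure_mono hsub)
  rw [hmeas]
  refine ENNReal.ofReal_le_ofReal ?_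
  rw [inv_le_iff_one_le_mul₀ (by positivity)]
  have hchoose := choose_le_mul_card_binaryMatrices (ι := Fin m) (κ := Fin n) (d := d) (e := e)
    (by simpa using hde)
  simp only [Fintype.card_fin] at hchoose
  calc (1 : ℝ) ≤ (((m * n : ℕ) : ℝ) + 1) * (w * (m * n).choose (m * d)) :=
        one_le_mul_binomial_mean hp0 hp1 hk
    _ ≤ (((m * n : ℕ) : ℝ) + 1) * (w * ((Real.exp m * (d + 1) ^ m) *
          (Real.exp n * (e + 1) ^ n) * B.card)) := by gcongr
    _ = _ := by ring

lemma add_one_le_exp_two_mul_sqrt {x : ℝ} (hx : 0 ≤ x) : x + 1 ≤ Real.exp (2 * √x) := by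
  have h : (√x + 1) ^ 2 ≤ Real.exp (√x) ^ 2 := by
    gcongr
    exact Real.add_one_le_exp _
  rw [← Real.exp_nat_mul] at h
  push_cast at h
  nlinarith [Real.sq_sqrt hx, Real.sqrt_nonneg x]

lemma biregular_loss_le_exp {m n d e : ℕ} {K : ℝ} (hK : 1 ≤ K) (hn : 1 ≤ n) (hd : 1 ≤ d)
    (hm : (m : ℝ) ≤ K * n) (he : (e : ℝ) ≤ K * d) :
    (((m * n : ℕ) : ℝ) + 1) * ((Real.exp m * (d + 1) ^ m) * (Real.exp n * (e + 1) ^ n)) ≤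
      Real.exp ((7 * K + 1) * n * √d) := by
  have hsK : √K ≤ K := Real.sqrt_le_self_iff.2 (Or.inr hK)
  have hn' : (1 : ℝ) ≤ n := by exact_mod_cast hn
  have hsd : 1 ≤ √(d : ℝ) := Real.one_le_sqrt.2 (by exact_mod_cast hd)
  have hK0 : 0 ≤ K := by linarith
  have h1 : ((m * n : ℕ) : ℝ) + 1 ≤ Real.exp (2 * K * n * √d) := by
    calc ((m * n : ℕ) : ℝ) + 1 ≤ K * n ^ 2 + 1 := by
          push_cast
          nlinarith
      _ ≤ Real.exp (2 * √(K * n ^ 2)) := add_one_le_exp_two_mul_sqrt (by positivity)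
      _ ≤ _ := by
          rw [Real.exp_le_exp, Real.sqrt_mul hK0, Real.sqrt_sq (by positivity)]
          calc 2 * (√K * n) ≤ 2 * (K * n) := by gcongr
            _ = 2 * K * n * 1 := by ring
            _ ≤ _ := by gcongr
  have h2 : Real.exp m ≤ Real.exp (K * n * √d) := by
    rw [Real.exp_le_exp]
    calc (m : ℝ) ≤ K * n * 1 := by linarith
      _ ≤ _ := by gcongr
  have h3 : ((d : ℝ) + 1) ^ m ≤ Real.exp (2 * K * n * √d) := by
    calc ((d : ℝ) + 1) ^ m ≤ Real.exp (2 * √d) ^ m := by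
          gcongr
          exact add_one_le_exp_two_mul_sqrt (by positivity)
      _ = Real.exp (m * (2 * √d)) := (Real.exp_nat_mul _ _).symm
      _ ≤ _ := by
          rw [Real.exp_le_exp]
          calc (m : ℝ) * (2 * √d) ≤ K * n * (2 * √d) := by gcongr
            _ = _ := by ring
  have h4 : Real.exp n ≤ Real.exp (n * √d) := by
    rw [Real.exp_le_exp]
    exact le_mul_of_one_le_right (by positivity) hsd
  have h5 : ((e : ℝ) + 1) ^ n ≤ Real.exp (2 * K * n * √d) := by
    calc ((e : ℝ) + 1) ^ n ≤ Real.exp (2 * √e) ^ n := by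
          gcongr
          exact add_one_le_exp_two_mul_sqrt (by positivity)
      _ = Real.exp (n * (2 * √e)) := (Real.exp_nat_mul _ _).symm
      _ ≤ _ := by
          rw [Real.exp_le_exp]
          calc (n : ℝ) * (2 * √e) ≤ n * (2 * √(K * d)) := by gcongr
            _ = n * (2 * (√K * √d)) := by rw [Real.sqrt_mul hK0]
            _ ≤ n * (2 * (K * √d)) := by gcongr
            _ = _ := by ring
  calc _ ≤ Real.exp (2 * K * n * √d) * ((Real.exp (K * n * √d) * Real.exp (2 * K * n * √d)) *
        (Real.exp (n * √d) * Real.exp (2 * K * n * √d))) := by gcongr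
    _ = _ := by
        simp only [← Real.exp_add]
        congr 1
        ring

/-- **Lemma 1.** If `np = Ω(log n)` and `m/n → α < ∞`, with `mp` and `np` integers, then
`G(m,n,p)` is `(mp,np)`-regular with probability at least `exp(-O(n (np)^{1/2}))`. -/
theorem er_bipartite_regular_prob
    (α : ℝ) (m : ℕ → ℕ) (p : ℕ → ℝ)
    (hp : ∀ n, 0 ≤ p n ∧ p n ≤ 1)
    (hratio : Tendsto (fun n => (m n : ℝ) / n) atTop (𝓝 α))
    (hnp : ∃ c > (0 : ℝ), ∀ᶠ n : ℕ in atTop, c * Real.log n ≤ (n : ℝ) * p n)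
    (hint : ∀ n, (∃ k : ℕ, (m n : ℝ) * p n = k) ∧ (∃ k : ℕ, (n : ℝ) * p n = k)) :
    ∃ C > (0 : ℝ), ∀ᶠ n : ℕ in atTop,
      ENNReal.ofReal (Real.exp (-C * n * Real.sqrt ((n : ℝ) * p n))) ≤
        erMeas (m n) n (p n)
          {Y | (∀ i, ∑ j, Y i j = (n : ℝ) * p n) ∧ (∀ j, ∑ i, Y i j = (m n : ℝ) * p n)} := by
  obtain ⟨c, hc, hnp⟩ := hnp
  set K : ℝ := |α| + 1
  have hK : 1 ≤ K := by simp [K]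
  refine ⟨7 * K + 1, by positivity, ?_⟩
  have hm : ∀ᶠ n : ℕ in atTop, (m n : ℝ) / n < K :=
    hratio.eventually_lt_const ((le_abs_self α).trans_lt (lt_add_one _))
  filter_upwards [hnp, hm, eventually_ge_atTop 2] with n hn hmn hn2
  obtain ⟨⟨e, he⟩, ⟨d, hd⟩⟩ := hint n
  have hn0 : (0 : ℝ) < n := by exact_mod_cast (by omega : 0 < n)
  have hmK : (m n : ℝ) ≤ K * n := by
    rw [div_lt_iff₀ hn0] at hmn
    exact hmn.le
  have hlog : 0 < Real.log n := Real.log_pos (by exact_mod_cast (by omega : 1 < n))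
  have hd1 : 1 ≤ d := by
    have : (0 : ℝ) < d := hd ▸ (mul_pos hc hlog).trans_le hn
    exact_mod_cast this
  have heK : (e : ℝ) ≤ K * d := by
    rw [← he, ← hd, ← mul_assoc]
    exact mul_le_mul_of_nonneg_right hmK (hp n).1
  refine le_trans (ENNReal.ofReal_le_ofReal ?_)
    (inv_le_erMeas_biregular (hp n).1 (hp n).2 hd he)
  rw [hd, neg_mul, neg_mul, Real.exp_neg]
  exact inv_anti₀ (by positivity) (biregular_loss_le_exp hK (by omega) hd1 hmK heK)
end

section
/- Fix α ≥ 1 and let a = 1 − α^{−1/2}, b = 1 + α^{−1/2}. The measure μ consisting of the density q(x) = (α/((1+α)π|x|))·√((b² − x²)(x² − a²)) on [−b,−a] ∪ [a,b] together with a point mass of (α−1)/(α+1) at 0 is a probability measure, i.e., 2·∫_a^b q(x) dx + (α−1)/(α+1) = 1. -/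
open MeasureTheory
open scoped ENNReal

noncomputable def mpa (α : ℝ) : ℝ := 1 - (Real.sqrt α)⁻¹
noncomputable def mpb (α : ℝ) : ℝ := 1 + (Real.sqrt α)⁻¹

/-- Density of the absolutely continuous part of the limiting measure `μ`:
`q(x) = (α/((1+α)π|x|))·√((b² − x²)(x² − a²))` for `a ≤ |x| ≤ b`, and `0` otherwise. -/
noncomputable def qdens (α x : ℝ) : ℝ :=
  if mpa α ≤ |x| ∧ |x| ≤ mpb α then
    α / ((1 + α) * Real.pi * |x|) * Real.sqrt ((mpb α ^ 2 - x ^ 2) * (x ^ 2 - mpa α ^ 2))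
  else 0

/-- The limiting measure `μ`: density `qdens` plus a point mass `(α-1)/(α+1)` at `0`. -/
noncomputable def muMeas (α : ℝ) : Measure ℝ :=
  volume.withDensity (fun x => ENNReal.ofReal (qdens α x)) +
    ENNReal.ofReal ((α - 1) / (α + 1)) • Measure.dirac 0

theorem hasDerivAt_sqrt_term {A B x : ℝ} (hA : A < x ^ 2) (hB : x ^ 2 < B) :
    HasDerivAt (fun x : ℝ => √((B - x ^ 2) * (x ^ 2 - A)))
      (x * (A + B - 2 * x ^ 2) / √((B - x ^ 2) * (x ^ 2 - A))) x := by
  have h0 : (B - x ^ 2) * (x ^ 2 - A) ≠ 0 := (mul_pos (sub_pos.2 hB) (sub_pos.2 hA)).ne'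
  have hsq : HasDerivAt (fun x : ℝ => x ^ 2) (2 * x) x := by simpa using hasDerivAt_pow 2 x
  refine (((hsq.const_sub B).mul (hsq.sub_const A)).sqrt h0).congr_deriv ?_
  simp only [Pi.mul_apply]
  ring

theorem hasDerivAt_arcsin_sq {A B x : ℝ} (hA : A < x ^ 2) (hB : x ^ 2 < B) :
    HasDerivAt (fun x : ℝ => Real.arcsin ((2 * x ^ 2 - (A + B)) / (B - A)))
      (2 * x / √((B - x ^ 2) * (x ^ 2 - A))) x := by
  have hD : 0 < B - A := by linarith
  have hr : 0 < (B - x ^ 2) * (x ^ 2 - A) := mul_pos (sub_pos.2 hB) (sub_pos.2 hA)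
  have hsq : HasDerivAt (fun x : ℝ => x ^ 2) (2 * x) x := by simpa using hasDerivAt_pow 2 x
  have hw := ((hsq.const_mul 2).sub_const (A + B)).div_const (B - A)
  have h1 : (2 * x ^ 2 - (A + B)) / (B - A) ≠ -1 := by
    rw [Ne, div_eq_iff hD.ne']; intro h; linarith
  have h2 : (2 * x ^ 2 - (A + B)) / (B - A) ≠ 1 := by
    rw [Ne, div_eq_iff hD.ne']; intro h; linarith
  have hs : √(1 - ((2 * x ^ 2 - (A + B)) / (B - A)) ^ 2)
      = 2 * √((B - x ^ 2) * (x ^ 2 - A)) / (B - A) := by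
    rw [Real.sqrt_eq_iff_mul_self_eq_of_pos (by positivity)]
    field_simp
    rw [Real.sq_sqrt hr.le]
    ring
  refine ((Real.hasDerivAt_arcsin h1 h2).comp x hw).congr_deriv ?_
  rw [hs]
  have := Real.sqrt_pos.2 hr
  field_simp

theorem hasDerivAt_mul_arcsin_inv_sq {c A B x : ℝ} (hc : 0 ≤ c) (hcAB : c ^ 2 = A * B)
    (hx : 0 < x) (hA : A < x ^ 2) (hB : x ^ 2 < B) :
    HasDerivAt
      (fun x : ℝ => c * Real.arcsin (((A + B) * x ^ 2 - 2 * (A * B)) / (x ^ 2 * (B - A))))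
      (2 * (A * B) / (x * √((B - x ^ 2) * (x ^ 2 - A)))) x := by
  rcases hc.eq_or_lt with rfl | hc
  · simpa [← hcAB] using hasDerivAt_const x (0 : ℝ)
  have hD : 0 < B - A := by linarith
  have hB0 : 0 < B := by nlinarith
  have hA0 : 0 < A := by
    have : 0 < A * B := hcAB ▸ pow_pos hc 2
    exact pos_of_mul_pos_left this hB0.le
  have hr : 0 < (B - x ^ 2) * (x ^ 2 - A) := mul_pos (sub_pos.2 hB) (sub_pos.2 hA)
  have hsq : HasDerivAt (fun x : ℝ => x ^ 2) (2 * x) x := by simpa using hasDerivAt_pow 2 x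
  have hxD : 0 < x ^ 2 * (B - A) := by positivity
  have hw := ((hsq.const_mul (A + B)).sub_const (2 * (A * B))).div (hsq.mul_const (B - A)) hxD.ne'
  have h1 : ((A + B) * x ^ 2 - 2 * (A * B)) / (x ^ 2 * (B - A)) ≠ -1 := by
    rw [Ne, div_eq_iff hxD.ne']; intro h; nlinarith
  have h2 : ((A + B) * x ^ 2 - 2 * (A * B)) / (x ^ 2 * (B - A)) ≠ 1 := by
    rw [Ne, div_eq_iff hxD.ne']; intro h; nlinarith
  have hs : √(1 - (((A + B) * x ^ 2 - 2 * (A * B)) / (x ^ 2 * (B - A))) ^ 2)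
      = 2 * c * √((B - x ^ 2) * (x ^ 2 - A)) / (x ^ 2 * (B - A)) := by
    rw [Real.sqrt_eq_iff_mul_self_eq_of_pos (by positivity)]
    field_simp
    rw [Real.sq_sqrt hr.le, hcAB]
    ring
  refine (((Real.hasDerivAt_arcsin h1 h2).comp x hw).const_mul c).congr_deriv ?_
  rw [hs]
  have := Real.sqrt_pos.2 hr
  field_simp
  ring

/-- An antiderivative of `√((b² - x²)(x² - a²)) / x` on `(a, b)`. -/
noncomputable def sqrtDivPrimitive (a b x : ℝ) : ℝ :=
  (√((b ^ 2 - x ^ 2) * (x ^ 2 - a ^ 2))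
    + (a ^ 2 + b ^ 2) / 2 * Real.arcsin ((2 * x ^ 2 - (a ^ 2 + b ^ 2)) / (b ^ 2 - a ^ 2))
    - a * b * Real.arcsin
        (((a ^ 2 + b ^ 2) * x ^ 2 - 2 * (a ^ 2 * b ^ 2)) / (x ^ 2 * (b ^ 2 - a ^ 2)))) / 2

theorem hasDerivAt_sqrtDivPrimitive {a b x : ℝ} (ha : 0 ≤ a) (hax : a < x) (hxb : x < b) :
    HasDerivAt (sqrtDivPrimitive a b) (√((b ^ 2 - x ^ 2) * (x ^ 2 - a ^ 2)) / x) x := by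
  have hx : 0 < x := ha.trans_lt hax
  have hA : a ^ 2 < x ^ 2 := by gcongr
  have hB : x ^ 2 < b ^ 2 := by gcongr
  have hr : 0 < (b ^ 2 - x ^ 2) * (x ^ 2 - a ^ 2) := mul_pos (sub_pos.2 hB) (sub_pos.2 hA)
  have hc : 0 ≤ a * b := mul_nonneg ha (hx.trans hxb).le
  refine ((((hasDerivAt_sqrt_term hA hB).add
    ((hasDerivAt_arcsin_sq hA hB).const_mul ((a ^ 2 + b ^ 2) / 2))).sub
    (hasDerivAt_mul_arcsin_inv_sq hc (mul_pow a b 2) hx hA hB)).div_const 2).congr_deriv ?_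
  have := Real.sqrt_pos.2 hr
  field_simp
  rw [Real.sq_sqrt hr.le]
  ring

theorem continuousOn_sqrtDivPrimitive {a b : ℝ} (ha : 0 ≤ a) (hab : a < b) :
    ContinuousOn (sqrtDivPrimitive a b) (Set.Icc a b) := by
  have hD : b ^ 2 - a ^ 2 ≠ 0 := by nlinarith
  unfold sqrtDivPrimitive
  rcases ha.eq_or_lt with rfl | ha
  · simp only [zero_mul, sub_zero]
    fun_prop
  · have h : ∀ x ∈ Set.Icc a b, x ^ 2 * (b ^ 2 - a ^ 2) ≠ 0 := fun x hx =>
      mul_ne_zero (pow_ne_zero 2 (ha.trans_le hx.1).ne') hD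
    have h3 : ContinuousOn (fun x : ℝ => Real.arcsin
        (((a ^ 2 + b ^ 2) * x ^ 2 - 2 * (a ^ 2 * b ^ 2)) / (x ^ 2 * (b ^ 2 - a ^ 2))))
        (Set.Icc a b) :=
      Real.continuous_arcsin.comp_continuousOn (ContinuousOn.div (by fun_prop) (by fun_prop) h)
    fun_prop

theorem sqrtDivPrimitive_right {a b : ℝ} (ha : 0 ≤ a) (hab : a < b) :
    sqrtDivPrimitive a b b = Real.pi * (b - a) ^ 2 / 8 := by
  have hD : b ^ 2 - a ^ 2 ≠ 0 := by nlinarith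
  have hb : b ≠ 0 := (ha.trans_lt hab).ne'
  have h1 : (2 * b ^ 2 - (a ^ 2 + b ^ 2)) / (b ^ 2 - a ^ 2) = 1 := by
    rw [div_eq_one_iff_eq hD]; ring
  have h2 : ((a ^ 2 + b ^ 2) * b ^ 2 - 2 * (a ^ 2 * b ^ 2)) / (b ^ 2 * (b ^ 2 - a ^ 2)) = 1 := by
    rw [div_eq_one_iff_eq (by positivity)]; ring
  simp only [sqrtDivPrimitive, h1, h2, sub_self, zero_mul, Real.sqrt_zero, Real.arcsin_one]
  ring

theorem sqrtDivPrimitive_left {a b : ℝ} (ha : 0 ≤ a) (hab : a < b) :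
    sqrtDivPrimitive a b a = -(Real.pi * (b - a) ^ 2 / 8) := by
  have hD : b ^ 2 - a ^ 2 ≠ 0 := by nlinarith
  have h1 : (2 * a ^ 2 - (a ^ 2 + b ^ 2)) / (b ^ 2 - a ^ 2) = -1 := by
    rw [div_eq_iff hD]; ring
  have h2 : a * b * Real.arcsin
      (((a ^ 2 + b ^ 2) * a ^ 2 - 2 * (a ^ 2 * b ^ 2)) / (a ^ 2 * (b ^ 2 - a ^ 2)))
      = a * b * -(Real.pi / 2) := by
    rcases ha.eq_or_lt with rfl | ha
    · simp
    · rw [← Real.arcsin_neg_one]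
      congr 2
      rw [div_eq_iff (by positivity)]; ring
  simp only [sqrtDivPrimitive, h1, h2, sub_self, mul_zero, Real.sqrt_zero, Real.arcsin_neg_one]
  ring

theorem integral_sqrt_div {a b : ℝ} (ha : 0 ≤ a) (hab : a < b) :
    ∫ x in a..b, √((b ^ 2 - x ^ 2) * (x ^ 2 - a ^ 2)) / x = Real.pi * (b - a) ^ 2 / 4 := by
  have hcont := continuousOn_sqrtDivPrimitive ha hab
  have hderiv : ∀ x ∈ Set.Ioo a b, HasDerivAt (sqrtDivPrimitive a b)
      (√((b ^ 2 - x ^ 2) * (x ^ 2 - a ^ 2)) / x) x :=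
    fun x hx => hasDerivAt_sqrtDivPrimitive ha hx.1 hx.2
  have hfi : IntegrableOn (fun x => √((b ^ 2 - x ^ 2) * (x ^ 2 - a ^ 2)) / x) (Set.Ioc a b) :=
    intervalIntegral.integrableOn_deriv_of_nonneg hcont hderiv
      fun x hx => div_nonneg (Real.sqrt_nonneg _) (ha.trans hx.1.le)
  rw [intervalIntegral.integral_eq_sub_of_hasDerivAt_of_le hab.le hcont hderiv
      ((intervalIntegrable_iff_integrableOn_Ioc_of_le hab.le).2 hfi),
    sqrtDivPrimitive_right ha hab, sqrtDivPrimitive_left ha hab]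
  ring

theorem mpa_nonneg {α : ℝ} (hα : 1 ≤ α) : 0 ≤ mpa α :=
  sub_nonneg.2 (inv_le_one_of_one_le₀ (Real.one_le_sqrt.2 hα))

theorem mpa_lt_mpb {α : ℝ} (hα : 1 ≤ α) : mpa α < mpb α := by
  have : 0 < (√α)⁻¹ := inv_pos.2 (Real.sqrt_pos.2 (by linarith))
  unfold mpa mpb
  linarith

theorem qdens_abs (α x : ℝ) : qdens α |x| = qdens α x := by
  simp [qdens]

theorem qdens_nonneg {α : ℝ} (hα : 0 ≤ α) (x : ℝ) : 0 ≤ qdens α x := by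
  unfold qdens
  split_ifs <;> positivity

theorem setIntegral_Ioc_qdens {α : ℝ} (hα : 1 ≤ α) :
    ∫ x in Set.Ioc (mpa α) (mpb α), qdens α x = 1 / (1 + α) := by
  have hα0 : 0 < α := by linarith
  have hdens : ∀ x ∈ Set.Ioc (mpa α) (mpb α), qdens α x = α / ((1 + α) * Real.pi) *
      (√((mpb α ^ 2 - x ^ 2) * (x ^ 2 - mpa α ^ 2)) / x) := by
    intro x hx
    have hx0 : 0 < x := (mpa_nonneg hα).trans_lt hx.1
    rw [qdens, abs_of_pos hx0, if_pos ⟨hx.1.le, hx.2⟩]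
    field_simp
  have hwidth : (mpb α - mpa α) ^ 2 = 4 / α := by
    calc (mpb α - mpa α) ^ 2 = 4 * ((√α) ^ 2)⁻¹ := by unfold mpa mpb; ring
      _ = 4 / α := by rw [Real.sq_sqrt hα0.le]; rfl
  rw [setIntegral_congr_fun measurableSet_Ioc hdens, integral_const_mul,
    ← intervalIntegral.integral_of_le (mpa_lt_mpb hα).le,
    integral_sqrt_div (mpa_nonneg hα) (mpa_lt_mpb hα), hwidth]
  have := Real.pi_pos
  field_simp

theorem integral_qdens {α : ℝ} (hα : 1 ≤ α) : ∫ x, qdens α x = 2 / (1 + α) := by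
  have ha := mpa_nonneg hα
  have hsub : Set.Ioc (mpa α) (mpb α) ⊆ Set.Ioi 0 := fun x hx => ha.trans_lt hx.1
  have hzero : ∀ x ∈ Set.Ioi (0 : ℝ) \ Set.Ioc (mpa α) (mpb α), qdens α x = 0 := by
    intro x hx
    rw [qdens, abs_of_pos hx.1]
    split_ifs with h
    · have hxa : x = mpa α := by
        by_contra hne
        exact hx.2 ⟨lt_of_le_of_ne h.1 (Ne.symm hne), h.2⟩
      simp [hxa]
    · rfl
  calc ∫ x, qdens α x = ∫ x, qdens α |x| := by simp only [qdens_abs]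
    _ = 2 * ∫ x in Set.Ioi 0, qdens α x := integral_comp_abs
    _ = 2 * ∫ x in Set.Ioc (mpa α) (mpb α), qdens α x := by
      rw [setIntegral_eq_of_subset_of_forall_sdiff_eq_zero measurableSet_Ioi hsub hzero]
    _ = 2 / (1 + α) := by rw [setIntegral_Ioc_qdens hα]; ring

/-- **`μ` is a probability measure:** `2∫_a^b q(x) dx + (α-1)/(α+1) = 1`. -/
theorem muMeas_isProbability (α : ℝ) (hα : 1 ≤ α) :
    IsProbabilityMeasure (muMeas α) ∧
      2 * (∫ x in Set.Icc (mpa α) (mpb α), qdens α x) + (α - 1) / (α + 1) = 1 := by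
  have hα0 : 0 < 1 + α := by linarith
  have hq : Integrable (qdens α) :=
    Integrable.of_integral_ne_zero (by rw [integral_qdens hα]; positivity)
  refine ⟨⟨?_⟩, ?_⟩
  · have hatom : 0 ≤ (α - 1) / (α + 1) := div_nonneg (by linarith) (by linarith)
    rw [muMeas, Measure.add_apply, withDensity_apply _ MeasurableSet.univ, Measure.restrict_univ,
      ← ofReal_integral_eq_lintegral_ofReal hq (ae_of_all _ (qdens_nonneg (by linarith))),
      integral_qdens hα, Measure.smul_apply, measure_univ, smul_eq_mul, mul_one,
      ← ENNReal.ofReal_add (by positivity) hatom, ENNReal.ofReal_eq_one]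
    field_simp
    ring
  · rw [integral_Icc_eq_integral_Ioc, setIntegral_Ioc_qdens hα]
    field_simp
    ring
end
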